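/- arXiv:1807.06367 — 2 statements merged into one kernel-verified Lean document; each statement's English description precedes it below -/
import Mathlib

section
/- Let y_1, …, y_n ∈ ℝ^d and a > 0. Then ∫_{ℝ^d} ((1/√n) Σ_{j=1}^n sin(tᵀ y_j))² exp(-a‖t‖²) dt = (π^{d/2} / (2 n a^{d/2})) Σ_{i,j=1}^n [exp(-‖y_i - y_j‖²/(4a)) - exp(-‖y_i + y_j‖²/(4a))]. -/
open MeasureTheory Real
open scoped RealInnerProductSpace

lemma gauss_re (d : ℕ) (w t : EuclideanSpace ℝ (Fin d)) (a : ℝ) :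
    Real.cos ⟪t, w⟫ * Real.exp (-a * ‖t‖ ^ 2)
      = RCLike.re (Complex.exp (-(a : ℂ) * ‖t‖ ^ 2 + Complex.I * (⟪w, t⟫ : ℝ))) := by
  have h : (-(a : ℂ) * ‖t‖ ^ 2 + Complex.I * (⟪w, t⟫ : ℝ))
      = ((-a * ‖t‖ ^ 2 : ℝ) : ℂ) + (⟪w, t⟫ : ℝ) * Complex.I := by
    push_cast; ring
  rw [h, real_inner_comm]
  simp only [RCLike.re_eq_complex_re, Complex.exp_re, Complex.add_re, Complex.add_im,
    Complex.ofReal_re, Complex.ofReal_im, Complex.re_ofReal_mul, Complex.im_ofReal_mul,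
    Complex.I_re, Complex.I_im, mul_zero, mul_one, add_zero, zero_add]
  ring

lemma gauss_int (d : ℕ) (w : EuclideanSpace ℝ (Fin d)) (a : ℝ) (ha : 0 < a) :
    Integrable (fun t : EuclideanSpace ℝ (Fin d) =>
      Real.cos ⟪t, w⟫ * Real.exp (-a * ‖t‖ ^ 2)) := by
  simp_rw [gauss_re]
  exact (GaussianFourier.integrable_cexp_neg_mul_sq_norm_add (b := (a : ℂ))
    (by simpa using ha) Complex.I w).re

lemma gauss_val (d : ℕ) (w : EuclideanSpace ℝ (Fin d)) (a : ℝ) (ha : 0 < a) :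
    ∫ t : EuclideanSpace ℝ (Fin d), Real.cos ⟪t, w⟫ * Real.exp (-a * ‖t‖ ^ 2)
      = π ^ ((d : ℝ) / 2) / a ^ ((d : ℝ) / 2) * Real.exp (-‖w‖ ^ 2 / (4 * a)) := by
  simp_rw [gauss_re]
  have hb : 0 < ((a : ℂ)).re := by simpa using ha
  rw [integral_re (GaussianFourier.integrable_cexp_neg_mul_sq_norm_add hb Complex.I w),
    GaussianFourier.integral_cexp_neg_mul_sq_norm_add hb Complex.I w]
  rw [← Real.div_rpow pi_pos.le ha.le]
  have h : ((π : ℂ) / a) ^ ((Module.finrank ℝ (EuclideanSpace ℝ (Fin d)) : ℂ) / 2)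
      * Complex.exp (Complex.I ^ 2 * ‖w‖ ^ 2 / (4 * a))
      = (((π / a) ^ ((d : ℝ) / 2) * Real.exp (-‖w‖ ^ 2 / (4 * a)) : ℝ) : ℂ) := by
    rw [Complex.ofReal_mul, Complex.ofReal_cpow (by positivity)]
    simp
  rw [h]
  exact Complex.ofReal_re _

theorem stmt3 (d n : ℕ) (hn : 0 < n) (y : Fin n → EuclideanSpace ℝ (Fin d))
    (a : ℝ) (ha : 0 < a) :
    ∫ t : EuclideanSpace ℝ (Fin d),
        ((1 / Real.sqrt n) * ∑ j, Real.sin ⟪t, y j⟫) ^ 2 * Real.exp (-a * ‖t‖ ^ 2)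
      = π ^ ((d : ℝ) / 2) / (2 * n * a ^ ((d : ℝ) / 2)) *
          ∑ i, ∑ j, (Real.exp (-‖y i - y j‖ ^ 2 / (4 * a))
            - Real.exp (-‖y i + y j‖ ^ 2 / (4 * a))) := by
  have hpt : ∀ t : EuclideanSpace ℝ (Fin d),
      ((1 / Real.sqrt n) * ∑ j, Real.sin ⟪t, y j⟫) ^ 2 * Real.exp (-a * ‖t‖ ^ 2)
      = (1 / (2 * n)) * ∑ i, ∑ j,
        (Real.cos ⟪t, y i - y j⟫ * Real.exp (-a * ‖t‖ ^ 2)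
          - Real.cos ⟪t, y i + y j⟫ * Real.exp (-a * ‖t‖ ^ 2)) := by
    intro t
    have h1 : ∀ i j, (Real.cos ⟪t, y i - y j⟫ * Real.exp (-a * ‖t‖ ^ 2)
          - Real.cos ⟪t, y i + y j⟫ * Real.exp (-a * ‖t‖ ^ 2))
        = Real.sin ⟪t, y i⟫ * Real.sin ⟪t, y j⟫ * (2 * Real.exp (-a * ‖t‖ ^ 2)) := by
      intro i j
      rw [inner_sub_right, inner_add_right, Real.cos_sub, Real.cos_add]
      ring
    simp_rw [h1, ← Finset.sum_mul, ← Finset.sum_mul_sum]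
    rw [mul_pow, div_pow, Real.sq_sqrt (Nat.cast_nonneg n)]
    have : (n : ℝ) ≠ 0 := by positivity
    field_simp
  simp_rw [hpt]
  have hi : ∀ i j, Integrable (fun t : EuclideanSpace ℝ (Fin d) =>
      Real.cos ⟪t, y i - y j⟫ * Real.exp (-a * ‖t‖ ^ 2)
          - Real.cos ⟪t, y i + y j⟫ * Real.exp (-a * ‖t‖ ^ 2)) :=
    fun i j => (gauss_int d _ a ha).sub (gauss_int d _ a ha)
  rw [integral_const_mul, integral_finsetSum _
    (fun i _ => integrable_finsetSum _ (fun j _ => hi i j))]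
  simp_rw [integral_finsetSum _ (fun j _ => hi _ j),
    integral_sub (gauss_int d _ a ha) (gauss_int d _ a ha), gauss_val d _ a ha, ← mul_sub,
    ← Finset.mul_sum]
  rw [← mul_assoc]
  congr 1
  have : (n : ℝ) ≠ 0 := by positivity
  have : a ^ ((d : ℝ) / 2) ≠ 0 := by positivity
  field_simp
end

section
/- Let a > 0 and let μ be a probability measure on ℝ^d. The function Δ(μ) = ∫_{ℝ^d} (∫_{ℝ^d} sin(tᵀx) dμ(x))² exp(-a‖t‖²) dt equals 0 if and only if μ is reflected symmetric about the origin, i.e., μ(B) = μ(−B) for all Borel sets B. -/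
open MeasureTheory Real
open scoped RealInnerProductSpace

theorem stmt18 (d : ℕ) (a : ℝ) (ha : 0 < a)
    (μ : Measure (EuclideanSpace ℝ (Fin d))) [IsProbabilityMeasure μ] :
    (∫ t : EuclideanSpace ℝ (Fin d),
        (∫ x, Real.sin ⟪t, x⟫ ∂μ) ^ 2 * Real.exp (-a * ‖t‖ ^ 2)) = 0
      ↔ ∀ B : Set (EuclideanSpace ℝ (Fin d)), MeasurableSet B → μ B = μ (-B) := by
  have hI : ∀ t : EuclideanSpace ℝ (Fin d),
      (∫ x, Real.sin ⟪t, x⟫ ∂μ) = (charFun μ t).im := by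
    intro t
    have hint : Integrable (fun x : EuclideanSpace ℝ (Fin d) =>
        Complex.exp (⟪x, t⟫ * Complex.I)) μ := by
      refine Integrable.of_bound (C := 1)
        (Continuous.aestronglyMeasurable (by fun_prop)) (ae_of_all _ fun x => ?_)
      rw [Complex.norm_exp_ofReal_mul_I]
    rw [charFun_apply]
    have h := integral_im hint
    simp only [RCLike.im_to_complex] at h
    rw [← h]
    refine integral_congr_ae (ae_of_all _ fun x => ?_)
    simp only [Complex.exp_ofReal_mul_I_im]
    rw [real_inner_comm]
  have hcont : Continuous fun t : EuclideanSpace ℝ (Fin d) => (charFun μ t).im :=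
    Complex.continuous_im.comp continuous_charFun
  have hmap : ∀ t, charFun (μ.map (fun x => -x)) t = (starRingEnd ℂ) (charFun μ t) := by
    intro t
    have h := charFun_map_smul (μ := μ) (-1) t
    simp only [neg_smul, one_smul] at h
    rw [charFun_neg] at h
    exact h
  have hgauss : Integrable fun t : EuclideanSpace ℝ (Fin d) => Real.exp (-a * ‖t‖ ^ 2) := by
    have h := (GaussianFourier.integrable_cexp_neg_mul_sq_norm_add
      (V := EuclideanSpace ℝ (Fin d)) (b := (a : ℂ)) (by simpa using ha) 0 0).norm
    refine h.congr (ae_of_all _ fun t => ?_)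
    simp only [Complex.norm_exp]
    congr 1
    simp [← Complex.ofReal_pow]
  have hneg : ∀ B : Set (EuclideanSpace ℝ (Fin d)), MeasurableSet B →
      μ.map (fun x => -x) B = μ (-B) := by
    intro B hB
    rw [Measure.map_apply measurable_neg hB]
    rfl
  simp_rw [hI]
  constructor
  · intro h0
    have hcont2 : Continuous fun t : EuclideanSpace ℝ (Fin d) =>
        (charFun μ t).im ^ 2 * Real.exp (-a * ‖t‖ ^ 2) := by fun_prop
    have hint : Integrable fun t : EuclideanSpace ℝ (Fin d) =>
        (charFun μ t).im ^ 2 * Real.exp (-a * ‖t‖ ^ 2) := by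
      refine hgauss.mono' hcont2.aestronglyMeasurable (ae_of_all _ fun t => ?_)
      have h1 : |(charFun μ t).im| ≤ 1 :=
        (Complex.abs_im_le_norm _).trans (norm_charFun_le_one t)
      have h2 : (charFun μ t).im ^ 2 ≤ 1 := (sq_le_one_iff_abs_le_one _).2 h1
      rw [Real.norm_of_nonneg (by positivity)]
      exact mul_le_of_le_one_left (Real.exp_pos _).le h2
    rw [integral_eq_zero_iff_of_nonneg (fun t => by positivity) hint] at h0
    have h3 := Measure.eq_of_ae_eq h0 hcont2 continuous_zero
    have h4 : μ.map (fun x => -x) = μ := by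
      haveI : IsProbabilityMeasure (μ.map (fun x : EuclideanSpace ℝ (Fin d) => -x)) :=
        Measure.isProbabilityMeasure_map measurable_neg.aemeasurable
      refine Measure.ext_of_charFun (funext fun t => ?_)
      rw [hmap, Complex.conj_eq_iff_im]
      have h5 := congrFun h3 t
      simpa [(Real.exp_pos _).ne'] using h5
    intro B hB
    rw [← hneg B hB, h4]
  · intro h
    have h4 : μ.map (fun x => -x) = μ := by
      ext B hB
      rw [hneg B hB, h B hB]
    have h5 : ∀ t, (charFun μ t).im = 0 := by
      intro t
      rw [← Complex.conj_eq_iff_im, ← hmap, h4]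
    simp [h5]
end
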